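/- Let K ⊆ ℝ^d be the attractor of a Euclidean IFS of similitudes, endowed with its natural fractal structure. If F satisfies the open set condition (OSC), then the natural fractal structure is irreducible. -/

import Mathlib

open scoped ENNReal

namespace IFSMoran

variable {X : Type*} [MetricSpace X]

/-- The map `f_i = f_{i1} o ... o f_{in}` associated to a word `i = i1...in`
(a list of indices). -/
def wMap {k : ℕ} (f : Fin k → X → X) : List (Fin k) → X → X
  | [] => id
  | i :: w => f i ∘ wMap f w

/-- The piece `A_i = f_i(K)` of the natural fractal structure. -/
def piece {k : ℕ} (f : Fin k → X → X) (K : Set X) (w : List (Fin k)) : Set X :=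
  wMap f w '' K

/-- The natural fractal structure (levels indexed by words) is irreducible:
no level admits a proper subcovering. -/
def Irred {k : ℕ} (f : Fin k → X → X) (K : Set X) : Prop :=
  ∀ w : List (Fin k),
    ¬ piece f K w ⊆ ⋃ v ∈ {v : List (Fin k) | v.length = w.length ∧ v ≠ w}, piece f K v

/-- `H³ₙˢ(K) = inf_{l ≥ n} ∑_{i ∈ Σˡ} diam (A_i) ^ s`. -/
noncomputable def H3n {k : ℕ} (f : Fin k → X → X) (K : Set X) (s : ℝ) (n : ℕ) : ℝ≥0∞ :=
  ⨅ (l : ℕ) (_ : n ≤ l),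
    ∑ w : Fin l → Fin k, EMetric.diam (piece f K (List.ofFn w)) ^ s

/-- `H³ˢ(K) = lim_n H³ₙˢ(K)`; the sequence is nondecreasing in `n`, so the limit
is the supremum. -/
noncomputable def H3 {k : ℕ} (f : Fin k → X → X) (K : Set X) (s : ℝ) : ℝ≥0∞ :=
  ⨆ n, H3n f K s n

/-- Fractal dimension III: `dim³(K) = inf {s ≥ 0 : H³ˢ(K) = 0}`. -/
noncomputable def dim3 {k : ℕ} (f : Fin k → X → X) (K : Set X) : ℝ :=
  sInf {s : ℝ | 0 ≤ s ∧ H3 f K s = 0}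

/-- `H⁴ₙˢ(K)`: infimum of `∑ diam (A_i) ^ s` over finite coverings of `K` by
pieces indexed by words of length `≥ n`. -/
noncomputable def H4n {k : ℕ} (f : Fin k → X → X) (K : Set X) (s : ℝ) (n : ℕ) : ℝ≥0∞ :=
  ⨅ (𝒜 : Finset (List (Fin k))) (_ : ∀ w ∈ 𝒜, n ≤ w.length)
      (_ : K ⊆ ⋃ w ∈ 𝒜, piece f K w),
    ∑ w ∈ 𝒜, EMetric.diam (piece f K w) ^ s

/-- `H⁴ˢ(K) = lim_n H⁴ₙˢ(K)`; the sequence is nondecreasing in `n`, so the limit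
is the supremum. -/
noncomputable def H4 {k : ℕ} (f : Fin k → X → X) (K : Set X) (s : ℝ) : ℝ≥0∞ :=
  ⨆ n, H4n f K s n

/-- Fractal dimension IV: `dim⁴(K) = inf {s ≥ 0 : H⁴ˢ(K) = 0}`. -/
noncomputable def dim4 {k : ℕ} (f : Fin k → X → X) (K : Set X) : ℝ :=
  sInf {s : ℝ | 0 ≤ s ∧ H4 f K s = 0}

/-- Interior of `A` relative to `K` (as a subset of the ambient space `X`). -/
def intK (K A : Set X) : Set X := K \ closure (K \ A)

/-- The level separation property: interiors (in `K`) of two pieces indexed by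
distinct words of the same length are disjoint (LSP1), and every piece has
nonempty interior in `K` (LSP2). -/
def LSP {k : ℕ} (f : Fin k → X → X) (K : Set X) : Prop :=
  (∀ v w : List (Fin k), v.length = w.length → v ≠ w →
      intK K (piece f K v) ∩ intK K (piece f K w) = ∅) ∧
  ∀ w : List (Fin k), (intK K (piece f K w)).Nonempty

/-- The natural fractal structure is a tiling: pieces indexed by distinct words
of the same length have disjoint interiors in `K`, and every piece is regularly
closed in `K`, i.e. `cl_K (int_K (A_i)) = A_i`. -/
def IsTiling {k : ℕ} (f : Fin k → X → X) (K : Set X) : Prop :=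
  (∀ v w : List (Fin k), v.length = w.length → v ≠ w →
      intK K (piece f K v) ∩ intK K (piece f K w) = ∅) ∧
  ∀ w : List (Fin k), closure (intK K (piece f K w)) ∩ K = piece f K w

section Words

variable {Y : Type*} {k : ℕ}

theorem wMap_append (f : Fin k → Y → Y) (u v : List (Fin k)) :
    wMap f (u ++ v) = wMap f u ∘ wMap f v := by
  induction u with
  | nil => rfl
  | cons i u ih => simp only [List.cons_append, wMap, ih, Function.comp_assoc]

theorem wMap_surjective {f : Fin k → Y → Y} (hf : ∀ i, Function.Surjective (f i))
    (w : List (Fin k)) : Function.Surjective (wMap f w) := by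
  induction w with
  | nil => exact Function.surjective_id
  | cons i w ih => exact (hf i).comp ih

theorem wMap_injective {f : Fin k → Y → Y} (hf : ∀ i, Function.Injective (f i))
    (w : List (Fin k)) : Function.Injective (wMap f w) := by
  induction w with
  | nil => exact Function.injective_id
  | cons i w ih => exact (hf i).comp ih

theorem wMap_mapsTo {f : Fin k → Y → Y} {V : Set Y} (hV : ∀ i, Set.MapsTo (f i) V V)
    (w : List (Fin k)) : Set.MapsTo (wMap f w) V V := by
  induction w with
  | nil => exact Set.mapsTo_id V
  | cons i w ih => exact (hV i).comp ih

/-- Under the open set condition, distinct words of the same length map `V` to disjoint sets. -/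
theorem disjoint_wMap_image {f : Fin k → Y → Y} {V : Set Y}
    (hinj : ∀ i, Function.Injective (f i)) (hV : ∀ i, Set.MapsTo (f i) V V)
    (hdisj : ∀ i j, i ≠ j → Disjoint (f i '' V) (f j '' V)) (v w : List (Fin k))
    (hlen : v.length = w.length) (hne : v ≠ w) :
    Disjoint (wMap f v '' V) (wMap f w '' V) := by
  induction v generalizing w with
  | nil => exact absurd (List.length_eq_zero_iff.1 hlen.symm).symm hne
  | cons i v ih =>
    cases w with
    | nil => simp at hlen
    | cons j w =>
      simp only [wMap, Set.image_comp]
      by_cases hij : i = j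
      · subst hij
        rw [Set.disjoint_image_iff (hinj i)]
        exact ih w (by simpa using hlen) (by simpa using hne)
      · exact (hdisj i j hij).mono (Set.image_mono (wMap_mapsTo hV v).image_subset)
          (Set.image_mono (wMap_mapsTo hV w).image_subset)

theorem dist_wMap {f : Fin k → X → X} {c : Fin k → ℝ}
    (hf : ∀ i x y, dist (f i x) (f i y) = c i * dist x y) (w : List (Fin k)) (x y : X) :
    dist (wMap f w x) (wMap f w y) = (w.map c).prod * dist x y := by
  induction w with
  | nil => simp [wMap]
  | cons i w ih => simp [wMap, hf, ih, mul_assoc]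

theorem prod_map_pos {c : Fin k → ℝ} (hc : ∀ i, 0 < c i) (w : List (Fin k)) :
    0 < (w.map c).prod := by
  induction w with
  | nil => simp
  | cons i w ih => simpa using mul_pos (hc i) ih

theorem prod_map_le_one {c : Fin k → ℝ} (hc : ∀ i, c i ∈ Set.Ioo (0 : ℝ) 1)
    (w : List (Fin k)) : (w.map c).prod ≤ 1 := by
  induction w with
  | nil => simp
  | cons i w ih =>
    simpa using mul_le_one₀ (hc i).2.le (prod_map_pos (fun i => (hc i).1) w).le ih

theorem pow_length_le_prod_map {c : Fin k → ℝ} {a : ℝ} (ha : 0 < a) (hac : ∀ i, a ≤ c i)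
    (w : List (Fin k)) : a ^ w.length ≤ (w.map c).prod := by
  induction w with
  | nil => simp
  | cons i w ih =>
    simp only [List.length_cons, List.map_cons, List.prod_cons, pow_succ']
    exact mul_le_mul (hac i) ih (by positivity) (ha.le.trans (hac i))

/-- Every point of the attractor lies in a piece whose ratio is comparable to `τ`. -/
theorem exists_piece_ratio {f : Fin k → Y → Y} {c : Fin k → ℝ}
    (hc : ∀ i, c i ∈ Set.Ioo (0 : ℝ) 1) {K : Set Y} (hK : K = ⋃ i, f i '' K)
    {a : ℝ} (ha : 0 < a) (hac : ∀ i, a ≤ c i) (ha1 : a ≤ 1)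
    {τ : ℝ} (hτ : 0 < τ) (hτ1 : τ ≤ 1) {z : Y} (hz : z ∈ K) :
    ∃ q : List (Fin k), z ∈ piece f K q ∧ (q.map c).prod ≤ τ ∧ a * τ ≤ (q.map c).prod := by
  obtain ⟨b, hb0, hb1, hcb⟩ : ∃ b : ℝ, 0 < b ∧ b < 1 ∧ ∀ i, c i ≤ b := by
    rw [hK, Set.mem_iUnion] at hz
    obtain ⟨i₀, -⟩ := hz
    obtain ⟨i, -, hi⟩ := Finset.exists_max_image Finset.univ c ⟨i₀, Finset.mem_univ _⟩
    exact ⟨c i, (hc i).1, (hc i).2, fun j => hi j (Finset.mem_univ _)⟩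
  obtain ⟨n, hn⟩ := exists_pow_lt_of_lt_one hτ hb1
  replace hn := hn.le
  induction n generalizing τ z with
  | zero =>
    refine ⟨[], ⟨z, hz, rfl⟩, by simpa using hn, ?_⟩
    simpa using mul_le_one₀ ha1 hτ.le hτ1
  | succ n ih =>
    have hz' := hz
    rw [hK, Set.mem_iUnion] at hz'
    obtain ⟨i, z', hz', rfl⟩ := hz'
    rcases le_total (c i) τ with h | h
    · refine ⟨[i], ⟨z', hz', rfl⟩, by simpa using h, ?_⟩
      simpa using (mul_le_of_le_one_right ha.le hτ1).trans (hac i)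
    · have hi := (hc i).1
      obtain ⟨q, ⟨y, hy, hyz⟩, hq1, hq2⟩ := ih (τ := τ / c i) (div_pos hτ hi)
        ((div_le_one hi).2 h) hz' (by
          rw [le_div_iff₀ hi]
          refine le_trans ?_ hn
          rw [pow_succ]
          exact mul_le_mul_of_nonneg_left (hcb i) (by positivity))
      refine ⟨i :: q, ⟨y, hy, congrArg (f i) hyz⟩, ?_, ?_⟩
      · rw [List.map_cons, List.prod_cons]
        rwa [le_div_iff₀ hi, mul_comm] at hq1
      · rw [List.map_cons, List.prod_cons]
        rwa [← mul_div_assoc, div_le_iff₀ hi, mul_comm _ (c i)] at hq2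

/-- If the piece of `w` is covered by the other pieces of its level, there are arbitrarily many
words of comparable ratio whose pieces share a point and whose images of `V` are disjoint. -/
theorem exists_words_of_not_irred {f : Fin k → Y → Y}
    {c : Fin k → ℝ} (hc : ∀ i, c i ∈ Set.Ioo (0 : ℝ) 1)
    (hinj : ∀ i, Function.Injective (f i)) {K : Set Y} (hKne : K.Nonempty)
    (hK : K = ⋃ i, f i '' K) {V : Set Y} (hV : ∀ i, Set.MapsTo (f i) V V)
    (hdisj : ∀ i j, i ≠ j → Disjoint (f i '' V) (f j '' V)) {w : List (Fin k)}
    (hw : piece f K w ⊆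
      ⋃ v ∈ {v : List (Fin k) | v.length = w.length ∧ v ≠ w}, piece f K v) :
    ∃ L : ℝ, 0 < L ∧ ∀ m : ℕ, ∃ x ∈ K, ∃ ρ : ℝ, 0 < ρ ∧ ρ ≤ 1 ∧
      ∃ u : Fin m → List (Fin k),
        (∀ i j, i ≠ j → Disjoint (wMap f (u i) '' V) (wMap f (u j) '' V)) ∧
        ∀ i, x ∈ piece f K (u i) ∧ ((u i).map c).prod ≤ ρ ∧ L * ρ ≤ ((u i).map c).prod := by
  have hpos : ∀ i, 0 < c i := fun i => (hc i).1
  have hKmaps : ∀ i, Set.MapsTo (f i) K K := fun i x hx => by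
    rw [hK]
    exact Set.mem_iUnion.2 ⟨i, x, hx, rfl⟩
  obtain ⟨a, ha, ha1, hac⟩ : ∃ a : ℝ, 0 < a ∧ a ≤ 1 ∧ ∀ i, a ≤ c i := by
    obtain ⟨z, hz⟩ := hKne
    rw [hK, Set.mem_iUnion] at hz
    obtain ⟨i₀, -⟩ := hz
    obtain ⟨i, -, hi⟩ := Finset.exists_min_image Finset.univ c ⟨i₀, Finset.mem_univ _⟩
    exact ⟨c i, (hc i).1, (hc i).2.le, fun j => hi j (Finset.mem_univ _)⟩
  refine ⟨a ^ w.length * a, by positivity, fun m => ?_⟩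
  induction m with
  | zero =>
    obtain ⟨x, hx⟩ := hKne
    exact ⟨x, hx, 1, one_pos, le_rfl, Fin.elim0, fun i => i.elim0, fun i => i.elim0⟩
  | succ m ih =>
    obtain ⟨x, hx, ρ, hρ, hρ1, u, hu, hux⟩ := ih
    have hwpos := prod_map_pos hpos w
    have hρ' : 0 < (w.map c).prod * ρ := mul_pos hwpos hρ
    have hρ1' : (w.map c).prod * ρ ≤ 1 := mul_le_one₀ (prod_map_le_one hc w) hρ.le hρ1
    obtain ⟨v, ⟨hvlen, hvw⟩, z, hz, hzx⟩ : ∃ v : List (Fin k),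
        (v.length = w.length ∧ v ≠ w) ∧ wMap f w x ∈ piece f K v := by
      simpa using hw ⟨x, hx, rfl⟩
    obtain ⟨q, ⟨y, hy, hyz⟩, hq1, hq2⟩ := exists_piece_ratio hc hK ha hac ha1 hρ' hρ1' hz
    have hnew : ∀ i, Disjoint (wMap f (v ++ q) '' V) (wMap f (w ++ u i) '' V) := fun i => by
      rw [wMap_append, wMap_append, Set.image_comp, Set.image_comp]
      exact (disjoint_wMap_image hinj hV hdisj v w hvlen hvw).mono
        (Set.image_mono (wMap_mapsTo hV q).image_subset)
        (Set.image_mono (wMap_mapsTo hV (u i)).image_subset)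
    refine ⟨wMap f w x, wMap_mapsTo hKmaps w hx, _, hρ', hρ1',
      Fin.cons (v ++ q) fun i => w ++ u i, ?_, ?_⟩
    · intro i j
      refine Fin.cases ?_ (fun i => ?_) i <;> refine Fin.cases ?_ (fun j => ?_) j
      · exact fun h => absurd rfl h
      · exact fun _ => hnew j
      · exact fun _ => (hnew i).symm
      · intro hij
        simp only [Fin.cons_succ, wMap_append, Set.image_comp]
        rw [Set.disjoint_image_iff (wMap_injective hinj w)]
        exact hu i j fun h => hij (congrArg Fin.succ h)
    · refine Fin.cases ?_ fun i => ?_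
      · simp only [Fin.cons_zero, List.map_append, List.prod_append]
        refine ⟨⟨y, hy, by rw [wMap_append, Function.comp_apply, hyz, hzx]⟩, ?_, ?_⟩
        · exact (mul_le_of_le_one_left (prod_map_pos hpos q).le (prod_map_le_one hc v)).trans hq1
        · rw [mul_assoc]
          refine mul_le_mul ?_ hq2 (by positivity) (prod_map_pos hpos v).le
          rw [← hvlen]
          exact pow_length_le_prod_map ha hac v
      · simp only [Fin.cons_succ, List.map_append, List.prod_append]
        obtain ⟨⟨y, hy, hyx⟩, h1, h2⟩ := hux i
        refine ⟨⟨y, hy, by rw [wMap_append, Function.comp_apply, hyx]⟩,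
          mul_le_mul_of_nonneg_left h1 hwpos.le, ?_⟩
        rw [mul_left_comm]
        exact mul_le_mul_of_nonneg_left h2 hwpos.le

end Words

/-- A similitude of a finite-dimensional Euclidean space is surjective. -/
theorem surjective_of_dist_eq_mul {E : Type*} [NormedAddCommGroup E] [InnerProductSpace ℝ E]
    [FiniteDimensional ℝ E] {g : E → E} {c : ℝ} (hc : 0 < c)
    (hg : ∀ x y, dist (g x) (g y) = c * dist x y) : Function.Surjective g := by
  have hiso : Isometry fun x => c⁻¹ • g x := Isometry.of_dist_eq fun x y => by
    rw [dist_smul₀, hg, Real.norm_of_nonneg (inv_nonneg.2 hc.le), inv_mul_cancel_left₀ hc.ne']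
  let φ := hiso.affineIsometryOfStrictConvexSpace
  have hlin : Function.Surjective φ.toAffineMap.linear :=
    LinearMap.surjective_of_injective (φ.toAffineMap.linear_injective_iff.2 φ.injective)
  have hsurj : Function.Surjective φ.toAffineMap := φ.toAffineMap.linear_surjective_iff.1 hlin
  intro y
  obtain ⟨x, hx⟩ := hsurj (c⁻¹ • y)
  exact ⟨x, smul_right_injective E (inv_ne_zero hc.ne') hx⟩

/-- Separated families in a ball of a finite-dimensional space have bounded cardinality,
uniformly under rescaling. -/
theorem exists_card_bound_of_separated {E : Type*} [NormedAddCommGroup E] [NormedSpace ℝ E]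
    [FiniteDimensional ℝ E] (D : ℝ) {ε : ℝ} (hε : 0 < ε) :
    ∃ N : ℕ, ∀ (m : ℕ) (x : E) (ρ : ℝ), 0 < ρ → ∀ p : Fin m → E,
      (∀ i, dist (p i) x ≤ ρ * D) → (∀ i j, i ≠ j → ρ * ε ≤ dist (p i) (p j)) → m ≤ N := by
  have : ProperSpace E := FiniteDimensional.proper ℝ E
  obtain ⟨t, -, htf, ht⟩ :=
    (isCompact_closedBall (0 : E) D).finite_cover_balls (half_pos hε)
  refine ⟨htf.toFinset.card, fun m x ρ hρ p hp hsep => ?_⟩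
  have hmem : ∀ i, ∃ z ∈ t, dist (ρ⁻¹ • (p i - x)) z < ε / 2 := fun i => by
    have : ρ⁻¹ • (p i - x) ∈ Metric.closedBall (0 : E) D := by
      rw [mem_closedBall_zero_iff, norm_smul, Real.norm_of_nonneg (inv_nonneg.2 hρ.le),
        inv_mul_le_iff₀ hρ, ← dist_eq_norm]
      exact hp i
    simpa using ht this
  choose z hzt hz using hmem
  have hinj : Function.Injective z := fun i j hij => by
    by_contra hne
    have h1 : dist (ρ⁻¹ • (p i - x)) (ρ⁻¹ • (p j - x)) < ε := by
      have hj := hz j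
      rw [← hij] at hj
      linarith [dist_triangle_right (ρ⁻¹ • (p i - x)) (ρ⁻¹ • (p j - x)) (z i), hz i]
    rw [dist_smul₀, Real.norm_of_nonneg (inv_nonneg.2 hρ.le), dist_sub_right,
      inv_mul_lt_iff₀ hρ] at h1
    exact absurd (hsep i j hne) (not_le.2 h1)
  simpa using Finset.card_le_card_of_injOn (s := Finset.univ) (t := htf.toFinset) z
    (fun i _ => by simpa using hzt i) hinj.injOn

theorem stmt_17 {d : ℕ} {k : ℕ} (hk : 2 ≤ k)
    (f : Fin k → EuclideanSpace ℝ (Fin d) → EuclideanSpace ℝ (Fin d)) (c : Fin k → ℝ)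
    (hc : ∀ i, c i ∈ Set.Ioo (0 : ℝ) 1)
    (hf : ∀ i x y, dist (f i x) (f i y) = c i * dist x y)
    (K : Set (EuclideanSpace ℝ (Fin d))) (hKne : K.Nonempty) (hKcp : IsCompact K)
    (hK : K = ⋃ i, f i '' K)
    (hOSC : ∃ V : Set (EuclideanSpace ℝ (Fin d)), V.Nonempty ∧ IsOpen V ∧
      (∀ i, f i '' V ⊆ V) ∧ ∀ i j, i ≠ j → Disjoint (f i '' V) (f j '' V)) :
    Irred f K := by
  intro w hw
  obtain ⟨V, ⟨y, hy⟩, hVo, hV, hdisj⟩ := hOSC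
  have hpos : ∀ i, 0 < c i := fun i => (hc i).1
  have hinj : ∀ i, Function.Injective (f i) := fun i x x' h => by
    have h0 := hf i x x'
    rw [h, dist_self, eq_comm, mul_eq_zero] at h0
    exact dist_eq_zero.1 (h0.resolve_left (hpos i).ne')
  have hsurj := wMap_surjective fun i => surjective_of_dist_eq_mul (hpos i) (hf i)
  obtain ⟨L, hL, hwords⟩ := exists_words_of_not_irred hc hinj hKne hK
    (fun i => Set.mapsTo_iff_image_subset.2 (hV i)) hdisj hw
  obtain ⟨r, hr, hball⟩ := Metric.isOpen_iff.1 hVo y hy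
  obtain ⟨D, hD⟩ := hKcp.isBounded.subset_closedBall y
  obtain ⟨N, hN⟩ := exists_card_bound_of_separated (E := EuclideanSpace ℝ (Fin d)) D
    (mul_pos hL hr)
  obtain ⟨x, -, ρ, hρ, -, u, hu, hux⟩ := hwords (N + 1)
  refine absurd (hN (N + 1) x ρ hρ (fun i => wMap f (u i) y) (fun i => ?_) fun i j hij => ?_)
    (Nat.not_succ_le_self N)
  · obtain ⟨⟨z, hz, hzx⟩, hle, -⟩ := hux i
    rw [← hzx, dist_wMap hf]
    exact mul_le_mul hle (Metric.mem_closedBall'.1 (hD hz)) dist_nonneg hρ.le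
  · by_contra hlt
    rw [not_le] at hlt
    obtain ⟨z, hz⟩ := hsurj (u i) (wMap f (u j) y)
    have hzV : z ∈ V := hball <| by
      rw [Metric.mem_ball']
      rw [← hz, dist_wMap hf] at hlt
      have hρL : ρ * (L * r) ≤ ((u i).map c).prod * r := by
        rw [← mul_assoc, mul_comm ρ L]
        exact mul_le_mul_of_nonneg_right (hux i).2.2 hr.le
      exact lt_of_mul_lt_mul_left (hlt.trans_le hρL) (prod_map_pos hpos (u i)).le
    exact Set.disjoint_left.1 (hu i j hij) ⟨z, hzV, hz⟩ ⟨y, hy, rfl⟩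

end IFSMoran
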